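/- arXiv:2110.15205 — 2 statements merged into one kernel-verified Lean document; each statement's English description precedes it below -/
import Mathlib

section
/- Let n, m, r be positive integers and T : ℓ1^n → ℓ2^m a linear map with rank(T) ≤ r. Then ‖T‖ ≤ π2(T*) ≤ ν1(T) ≤ √(2r) ‖T‖, where ‖T‖ is the operator norm and T* : ℓ2^m → ℓ∞^n is the adjoint map. -/
open Real Set
open scoped RealInnerProductSpace

/-- The 2-summing norm of a continuous linear map `S : F → G`. -/
noncomputable def pi2 {F G : Type*} [NormedAddCommGroup F] [NormedSpace ℝ F]
    [NormedAddCommGroup G] [NormedSpace ℝ G] (S : F →L[ℝ] G) : ℝ :=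
  sInf {c | 0 ≤ c ∧ ∀ (k : ℕ) (x : Fin k → F),
    Real.sqrt (∑ i, ‖S (x i)‖^2)
      ≤ c * sSup {t | ∃ φ : F →L[ℝ] ℝ, ‖φ‖ ≤ 1 ∧ t = Real.sqrt (∑ i, (φ (x i))^2)}}

/-- The 1-nuclear norm of a continuous linear map `S : F → G`. -/
noncomputable def nu1 {F G : Type*} [NormedAddCommGroup F] [NormedSpace ℝ F]
    [NormedAddCommGroup G] [NormedSpace ℝ G] (S : F →L[ℝ] G) : ℝ :=
  sInf {c | ∃ (s : ℕ) (φ : Fin s → (F →L[ℝ] ℝ)) (y : Fin s → G),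
    (∀ x, S x = ∑ i, φ i x • y i) ∧ c = ∑ i, ‖φ i‖ * ‖y i‖}

/-- the `i`-th standard basis vector of `ℓ1^n` -/
noncomputable def l1basis (n : ℕ) (i : Fin n) : PiLp 1 (fun _ : Fin n => ℝ) :=
  (WithLp.equiv 1 (Fin n → ℝ)).symm (Pi.single i 1)

open MeasureTheory ProbabilityTheory

theorem integral_abs_gaussianReal :
    ∫ x, |x| ∂(gaussianReal 0 1) = √(2 / π) := by
  have half : ∫ x in Ioi (0 : ℝ), x * rexp (-(1 / 2) * x ^ 2) = 1 := by
    have := integral_rpow_mul_exp_neg_mul_rpow (p := 2) (q := 1) (b := 1 / 2)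
      (by norm_num) (by norm_num) (by norm_num)
    norm_num [Real.rpow_neg_one] at this
    simpa using this
  have even : ∫ x : ℝ, |x| * rexp (-(1 / 2) * x ^ 2) = 2 := by
    have := integral_comp_abs (f := fun x => x * rexp (-(1 / 2) * x ^ 2))
    simpa only [sq_abs, half, mul_one] using this
  rw [integral_gaussianReal_eq_integral_smul one_ne_zero]
  have : ∀ x : ℝ, gaussianPDFReal 0 1 x • |x|
      = (√(2 * π))⁻¹ * (|x| * rexp (-(1 / 2) * x ^ 2)) := by
    intro x
    rw [gaussianPDFReal]
    simp only [NNReal.coe_one, sub_zero, smul_eq_mul, mul_one]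
    rw [show -x ^ 2 / 2 = -(1 / 2) * x ^ 2 by ring]
    ring
  simp_rw [this]
  rw [integral_const_mul, even, eq_comm, Real.sqrt_eq_iff_mul_self_eq (by positivity) (by positivity)]
  have h := Real.mul_self_sqrt (show 0 ≤ 2 * π by positivity)
  field_simp
  rw [sq, h]

section StdGaussian

variable {E : Type*} [NormedAddCommGroup E] [InnerProductSpace ℝ E] [FiniteDimensional ℝ E]
  [MeasurableSpace E] [BorelSpace E]

theorem integral_inner_sq_stdGaussian (b : E) :
    ∫ g, ⟪b, g⟫ ^ 2 ∂(stdGaussian E) = ‖b‖ ^ 2 := by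
  have h := variance_dual_stdGaussian (innerSL ℝ b)
  rw [variance_of_integral_eq_zero (by fun_prop) (integral_strongDual_stdGaussian _)] at h
  simpa using h

theorem integral_abs_inner_stdGaussian (a : E) :
    ∫ g, |⟪a, g⟫| ∂(stdGaussian E) = ‖a‖ * √(2 / π) := by
  have key : (stdGaussian E).map (innerSL ℝ a) = (gaussianReal 0 1).map (‖a‖ * ·) := by
    rw [IsGaussian.map_eq_gaussianReal, integral_strongDual_stdGaussian, variance_dual_stdGaussian,
      gaussianReal_map_const_mul]
    congr 1
    · simp
    · ext; simp
  have h1 : ∫ g, |⟪a, g⟫| ∂(stdGaussian E)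
      = ∫ x, |x| ∂((stdGaussian E).map (innerSL ℝ a)) := by
    rw [integral_map (by fun_prop) (by fun_prop)]
    simp
  rw [h1, key, integral_map (by fun_prop) (by fun_prop)]
  simp_rw [abs_mul, abs_norm]
  rw [integral_const_mul, integral_abs_gaussianReal]

theorem measurable_sign_inner (a : E) :
    Measurable fun g : E => ((SignType.sign ⟪a, g⟫ : SignType) : ℝ) := by
  have h (x : ℝ) : ((SignType.sign x : SignType) : ℝ) =
      if 0 < x then 1 else if x < 0 then -1 else 0 := by
    rw [sign_apply]
    split_ifs <;> simp
  simp_rw [h]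
  exact Measurable.ite (measurableSet_lt measurable_const (by fun_prop)) measurable_const
    (Measurable.ite (measurableSet_lt (by fun_prop) measurable_const) measurable_const
      measurable_const)

theorem measurableSet_sign_inner_eq (a : E) (s : SignType) :
    MeasurableSet {g : E | SignType.sign ⟪a, g⟫ = s} := by
  have h : {g : E | SignType.sign ⟪a, g⟫ = s}
      = (fun g : E => ((SignType.sign ⟪a, g⟫ : SignType) : ℝ)) ⁻¹' {(s : ℝ)} := by
    have cast_inj (t : SignType) : (t : ℝ) = s ↔ t = s := by
      rcases t.trichotomy with rfl | rfl | rfl <;> rcases s.trichotomy with rfl | rfl | rfl <;>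
        (norm_num; try decide)
    ext g
    exact (cast_inj _).symm
  rw [h]
  exact measurable_sign_inner a (measurableSet_singleton _)

theorem integrable_sign_smul_stdGaussian (a : E) :
    Integrable (fun g => (SignType.sign ⟪a, g⟫ : ℝ) • g) (stdGaussian E) := by
  refine (IsGaussian.integrable_id (μ := stdGaussian E)).bdd_smul 1
    (measurable_sign_inner a).aestronglyMeasurable (.of_forall fun g => ?_)
  cases SignType.sign ⟪a, g⟫ <;> simp

theorem integral_sign_smul_stdGaussian (a : E) :
    ‖a‖ • ∫ g, (SignType.sign ⟪a, g⟫ : ℝ) • g ∂(stdGaussian E) = √(2 / π) • a := by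
  set I := ∫ g, (SignType.sign ⟪a, g⟫ : ℝ) • g ∂(stdGaussian E) with hI
  have hint := integrable_sign_smul_stdGaussian a
  set R := (Submodule.span ℝ {a}).reflection
  have hRa : R a = a :=
    Submodule.reflection_mem_subspace_eq_self (Submodule.mem_span_singleton_self a)
  have hsymm (g : E) : ⟪a, R g⟫ = ⟪a, g⟫ := by
    nth_rewrite 1 [← hRa]
    exact R.inner_map_map a g
  have hRI : R I = I := by
    have h1 : ∫ g, (SignType.sign ⟪a, g⟫ : ℝ) • g ∂((stdGaussian E).map R) = I := by
      rw [stdGaussian_map]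
    rw [integral_map R.continuous.aemeasurable
      (by rw [stdGaussian_map]; exact hint.aestronglyMeasurable)] at h1
    simp_rw [hsymm] at h1
    have h2 := R.toContinuousLinearEquiv.toContinuousLinearMap.integral_comp_comm hint
    simp only [map_smul] at h2
    exact h2.symm.trans h1
  obtain ⟨t, ht⟩ := Submodule.mem_span_singleton.1
    ((Submodule.reflection_eq_self_iff I).1 hRI)
  have hinner : ⟪a, I⟫ = ‖a‖ * √(2 / π) := by
    rw [hI, ← integral_inner hint, ← integral_abs_inner_stdGaussian]
    simp [inner_smul_right]
  rcases eq_or_ne a 0 with rfl | ha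
  · simp
  · rw [← ht, inner_smul_right, real_inner_self_eq_norm_sq] at hinner
    have : 0 < ‖a‖ := norm_pos_iff.2 ha
    rw [← ht, smul_smul]
    congr 1
    apply mul_left_cancel₀ this.ne'
    linarith

theorem integral_norm_stdGaussian_le :
    ∫ g, ‖g‖ ∂(stdGaussian E) ≤ √(Module.finrank ℝ E) := by
  have hL : MemLp (fun g : E => ‖g‖) 2 (stdGaussian E) :=
    (IsGaussian.memLp_id (stdGaussian E) 2 (by norm_num)).norm
  have hsq : ∫ g, ‖g‖ ^ 2 ∂(stdGaussian E) = Module.finrank ℝ E := by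
    let b := stdOrthonormalBasis ℝ E
    simp_rw [← b.sum_sq_inner_right]
    rw [integral_finsetSum]
    · simp [integral_inner_sq_stdGaussian]
    · intro i _
      exact (IsGaussian.memLp_dual (stdGaussian E) (innerSL ℝ (b i)) 2 (by norm_num)).integrable_sq
  apply Real.le_sqrt_of_sq_le
  have h := variance_nonneg (fun g : E => ‖g‖) (stdGaussian E)
  rw [variance_eq_sub hL] at h
  simp only [Pi.pow_apply, hsq] at h
  linarith

/-- Vectors `a i` are recovered from `‖a i‖` and the sign patterns of `g ↦ ⟪a i, g⟫`, with
coefficients obtained by averaging a standard Gaussian vector over each sign pattern. -/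
theorem exists_sign_representation {ι : Type*} [Fintype ι] [DecidableEq ι] (a : ι → E) :
    ∃ y : (ι → SignType) → E, (∀ i, a i = ∑ σ, (‖a i‖ * (σ i : ℝ)) • y σ) ∧
      ∑ σ, ‖y σ‖ ≤ √(2 * Module.finrank ℝ E) := by
  let κ (g : E) (i : ι) : SignType := SignType.sign ⟪a i, g⟫
  have hfib (σ : ι → SignType) : MeasurableSet (κ ⁻¹' {σ}) := by
    have : κ ⁻¹' {σ} = ⋂ i, {g | SignType.sign ⟪a i, g⟫ = σ i} := by
      ext g
      simp [κ, funext_iff]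
    rw [this]
    exact MeasurableSet.iInter fun i => measurableSet_sign_inner_eq (a i) (σ i)
  have hdisj : Pairwise (Function.onFun Disjoint fun σ => κ ⁻¹' {σ}) := fun σ τ h =>
    Disjoint.preimage _ (disjoint_singleton.2 h)
  have hcover : ⋃ σ, κ ⁻¹' {σ} = univ := by ext; simp
  have hpos : 0 < √(2 / π) := by positivity
  refine ⟨fun σ => (√(2 / π))⁻¹ • ∫ g in κ ⁻¹' {σ}, g ∂(stdGaussian E), fun i => ?_, ?_⟩
  · have hI : ∫ g, (SignType.sign ⟪a i, g⟫ : ℝ) • g ∂(stdGaussian E)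
        = ∑ σ : ι → SignType, (σ i : ℝ) • ∫ g in κ ⁻¹' {σ}, g ∂(stdGaussian E) := by
      rw [← setIntegral_univ, ← hcover, integral_iUnion_fintype hfib hdisj
        fun σ => (integrable_sign_smul_stdGaussian (a i)).integrableOn]
      refine Finset.sum_congr rfl fun σ _ => ?_
      rw [← integral_smul]
      refine setIntegral_congr_fun (hfib σ) fun g hg => ?_
      simp only [← show κ g = σ from hg, κ]
    have h := integral_sign_smul_stdGaussian (a i)
    rw [hI, ← inv_smul_eq_iff₀ hpos.ne'] at h
    refine h.symm.trans ?_
    rw [Finset.smul_sum, Finset.smul_sum]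
    refine Finset.sum_congr rfl fun σ _ => ?_
    simp only [smul_smul]
    congr 1
    ring
  · calc ∑ σ, ‖(√(2 / π))⁻¹ • ∫ g in κ ⁻¹' {σ}, g ∂(stdGaussian E)‖
        ≤ ∑ σ, (√(2 / π))⁻¹ * ∫ g in κ ⁻¹' {σ}, ‖g‖ ∂(stdGaussian E) := by
          gcongr with σ
          rw [norm_smul, norm_inv, Real.norm_of_nonneg hpos.le]
          gcongr
          exact norm_integral_le_integral_norm _
      _ = (√(2 / π))⁻¹ * ∫ g, ‖g‖ ∂(stdGaussian E) := by
          have hint : Integrable (fun g : E => ‖g‖) (stdGaussian E) :=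
            IsGaussian.integrable_id.norm
          rw [← Finset.mul_sum, ← integral_iUnion_fintype hfib hdisj
            fun σ => hint.integrableOn, hcover, setIntegral_univ]
      _ ≤ √2 * √(Module.finrank ℝ E) := by
          gcongr
          · rw [← Real.sqrt_inv]
            apply Real.sqrt_le_sqrt
            rw [inv_div]
            linarith [Real.pi_le_four]
          · exact integral_norm_stdGaussian_le
      _ = √(2 * Module.finrank ℝ E) := (Real.sqrt_mul (by norm_num) _).symm

end StdGaussian

theorem norm_l1basis (n : ℕ) (i : Fin n) : ‖l1basis n i‖ = 1 := by
  simp [l1basis]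

theorem sum_smul_l1basis {n : ℕ} (x : PiLp 1 (fun _ : Fin n => ℝ)) :
    ∑ i, x i • l1basis n i = x := by
  ext j
  simp [l1basis, Pi.single_apply]

theorem exists_nuclear_representation {n : ℕ} {G : Type*} [NormedAddCommGroup G]
    [InnerProductSpace ℝ G] (T : PiLp 1 (fun _ : Fin n => ℝ) →L[ℝ] G) :
    ∃ (s : ℕ) (φ : Fin s → (PiLp 1 (fun _ : Fin n => ℝ) →L[ℝ] ℝ)) (y : Fin s → G),
      (∀ x, T x = ∑ i, φ i x • y i) ∧
      ∑ i, ‖φ i‖ * ‖y i‖ ≤ √(2 * Module.finrank ℝ T.range) * ‖T‖ := by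
  let a (i : Fin n) : T.range := ⟨T (l1basis n i), LinearMap.mem_range_self _ _⟩
  have ha (i : Fin n) : ‖a i‖ ≤ ‖T‖ := by
    simpa [norm_l1basis] using T.le_opNorm (l1basis n i)
  borelize (T.range : Type _)
  obtain ⟨y, hy, hsum⟩ := exists_sign_representation a
  let φ (σ : Fin n → SignType) : PiLp 1 (fun _ : Fin n => ℝ) →L[ℝ] ℝ :=
    ∑ i, (‖a i‖ * (σ i : ℝ)) • PiLp.proj 1 (fun _ : Fin n => ℝ) i
  have hφ_apply (σ : Fin n → SignType) (x : PiLp 1 (fun _ : Fin n => ℝ)) :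
      φ σ x = ∑ i, ‖a i‖ * (σ i : ℝ) * x i := by
    simp [φ]
  have hφ (σ : Fin n → SignType) : ‖φ σ‖ ≤ ‖T‖ := by
    refine (φ σ).opNorm_le_bound (norm_nonneg T) fun x => ?_
    rw [hφ_apply, PiLp.norm_eq_of_L1, Finset.mul_sum]
    refine (norm_sum_le _ _).trans (Finset.sum_le_sum fun i _ => ?_)
    rw [norm_mul, norm_mul, norm_norm]
    gcongr
    have : ‖(σ i : ℝ)‖ ≤ 1 := by cases σ i <;> simp
    exact (mul_le_of_le_one_right (norm_nonneg _) this).trans (ha i)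
  let e := Fintype.equivFin (Fin n → SignType)
  refine ⟨_, fun k => φ (e.symm k), fun k => (y (e.symm k) : G), fun x => ?_, ?_⟩
  · rw [e.symm.sum_comp fun σ => φ σ x • (y σ : G)]
    calc T x = ∑ i, x i • (a i : G) := by
          conv_lhs => rw [← sum_smul_l1basis x]
          simp [a]
      _ = ∑ i, x i • ∑ σ, (‖a i‖ * (σ i : ℝ)) • (y σ : G) := by
          refine Finset.sum_congr rfl fun i _ => ?_
          conv_lhs => rw [hy i]
          simp
      _ = ∑ σ, φ σ x • (y σ : G) := by
          simp_rw [Finset.smul_sum, hφ_apply, Finset.sum_smul, smul_smul]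
          rw [Finset.sum_comm]
          simp_rw [mul_comm]
  · rw [e.symm.sum_comp fun σ => ‖φ σ‖ * ‖(y σ : G)‖, mul_comm]
    calc ∑ σ, ‖φ σ‖ * ‖(y σ : G)‖ ≤ ∑ σ, ‖T‖ * ‖y σ‖ := by
          gcongr with σ
          exacts [hφ σ, le_rfl]
      _ ≤ ‖T‖ * √(2 * Module.finrank ℝ T.range) := by
          rw [← Finset.mul_sum]
          gcongr

/-- Minkowski's inequality for finite sums in `ℓ2`. -/
theorem sqrt_sum_sq_sum_le {ι κ : Type*} [Fintype ι] [Fintype κ] (f : κ → ι → ℝ) :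
    √(∑ i, (∑ j, f j i) ^ 2) ≤ ∑ j, √(∑ i, (f j i) ^ 2) := by
  have h := norm_sum_le Finset.univ fun j => WithLp.toLp 2 (f j)
  simpa [EuclideanSpace.norm_eq] using h

theorem bddAbove_weakly_summing {F : Type*} [NormedAddCommGroup F] [NormedSpace ℝ F] {k : ℕ}
    (x : Fin k → F) :
    BddAbove {t | ∃ φ : F →L[ℝ] ℝ, ‖φ‖ ≤ 1 ∧ t = √(∑ i, (φ (x i)) ^ 2)} := by
  refine ⟨√(∑ i, ‖x i‖ ^ 2), ?_⟩
  rintro _ ⟨φ, hφ, rfl⟩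
  gcongr √(∑ i, ?_) with i
  rw [← sq_abs]
  gcongr
  exact (φ.le_opNorm (x i)).trans (mul_le_of_le_one_left (norm_nonneg _) hφ)

theorem sqrt_sum_inner_sq_le {F : Type*} [NormedAddCommGroup F] [InnerProductSpace ℝ F] {k : ℕ}
    (x : Fin k → F) (y : F) :
    √(∑ i, ⟪y, x i⟫ ^ 2) ≤
      ‖y‖ * sSup {t | ∃ φ : F →L[ℝ] ℝ, ‖φ‖ ≤ 1 ∧ t = √(∑ i, (φ (x i)) ^ 2)} := by
  rcases eq_or_ne y 0 with rfl | hy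
  · simp
  have hy' : 0 < ‖y‖ := norm_pos_iff.2 hy
  have h : √(∑ i, (innerSL ℝ (‖y‖⁻¹ • y) (x i)) ^ 2) ≤
      sSup {t | ∃ φ : F →L[ℝ] ℝ, ‖φ‖ ≤ 1 ∧ t = √(∑ i, (φ (x i)) ^ 2)} := by
    refine le_csSup (bddAbove_weakly_summing x) ⟨_, ?_, rfl⟩
    rw [innerSL_apply_norm, norm_smul, norm_inv, norm_norm, inv_mul_cancel₀ hy'.ne']
  refine le_trans (le_of_eq ?_) (mul_le_mul_of_nonneg_left h hy'.le)
  simp_rw [innerSL_apply_apply, inner_smul_left, mul_pow, ← Finset.mul_sum]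
  rw [Real.sqrt_mul (by positivity), ← mul_assoc]
  simp [hy'.ne']

theorem sqrt_sum_sq_adjoint_le {n s k : ℕ} {G : Type*} [NormedAddCommGroup G]
    [InnerProductSpace ℝ G] (T : PiLp 1 (fun _ : Fin n => ℝ) →L[ℝ] G)
    (Tstar : G →L[ℝ] PiLp ⊤ (fun _ : Fin n => ℝ))
    (hTstar : ∀ (u : G) (i : Fin n), Tstar u i = ⟪T (l1basis n i), u⟫)
    (φ : Fin s → (PiLp 1 (fun _ : Fin n => ℝ) →L[ℝ] ℝ)) (y : Fin s → G)
    (hT : ∀ x, T x = ∑ j, φ j x • y j) (x : Fin k → G) :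
    √(∑ i, ‖Tstar (x i)‖ ^ 2) ≤ (∑ j, ‖φ j‖ * ‖y j‖) *
      sSup {t | ∃ φ : G →L[ℝ] ℝ, ‖φ‖ ≤ 1 ∧ t = √(∑ i, (φ (x i)) ^ 2)} := by
  have hpt (u : G) : ‖Tstar u‖ ≤ ∑ j, ‖φ j‖ * |⟪y j, u⟫| := by
    rw [PiLp.norm_eq_ciSup]
    refine Real.iSup_le (fun i => ?_) (by positivity)
    rw [hTstar, hT, sum_inner]
    refine (norm_sum_le _ _).trans (Finset.sum_le_sum fun j _ => ?_)
    rw [real_inner_smul_left, norm_mul, Real.norm_eq_abs ⟪y j, u⟫]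
    gcongr
    simpa [norm_l1basis] using (φ j).le_opNorm (l1basis n i)
  calc √(∑ i, ‖Tstar (x i)‖ ^ 2) ≤ √(∑ i, (∑ j, ‖φ j‖ * |⟪y j, x i⟫|) ^ 2) := by
        gcongr with i
        exact hpt (x i)
    _ ≤ ∑ j, √(∑ i, (‖φ j‖ * |⟪y j, x i⟫|) ^ 2) := sqrt_sum_sq_sum_le _
    _ = ∑ j, ‖φ j‖ * √(∑ i, ⟪y j, x i⟫ ^ 2) := by
        refine Finset.sum_congr rfl fun j _ => ?_
        simp_rw [mul_pow, sq_abs, ← Finset.mul_sum]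
        rw [Real.sqrt_mul (by positivity), Real.sqrt_sq (norm_nonneg _)]
    _ ≤ _ := by
        rw [Finset.sum_mul]
        refine Finset.sum_le_sum fun j _ => ?_
        rw [mul_assoc]
        gcongr
        exact sqrt_sum_inner_sq_le x (y j)

theorem norm_le_of_norm_adjoint_le {n : ℕ} {G : Type*} [NormedAddCommGroup G]
    [InnerProductSpace ℝ G] (T : PiLp 1 (fun _ : Fin n => ℝ) →L[ℝ] G)
    (Tstar : G →L[ℝ] PiLp ⊤ (fun _ : Fin n => ℝ))
    (hTstar : ∀ (u : G) (i : Fin n), Tstar u i = ⟪T (l1basis n i), u⟫) {c : ℝ} (hc : 0 ≤ c)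
    (h : ∀ u, ‖Tstar u‖ ≤ c * ‖u‖) : ‖T‖ ≤ c := by
  refine T.opNorm_le_bound hc fun x => ?_
  rcases eq_or_ne (T x) 0 with h0 | h0
  · rw [h0, norm_zero]; positivity
  have hpos : 0 < ‖T x‖ := norm_pos_iff.2 h0
  have key : ‖T x‖ * ‖T x‖ ≤ c * ‖x‖ * ‖T x‖ := by
    calc ‖T x‖ * ‖T x‖ = ∑ i, x i * Tstar (T x) i := by
          rw [← real_inner_self_eq_norm_mul_norm]
          nth_rewrite 1 [← sum_smul_l1basis x]
          simp [sum_inner, real_inner_smul_left, hTstar]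
      _ ≤ ∑ i, ‖x i‖ * ‖Tstar (T x)‖ := by
          refine Finset.sum_le_sum fun i _ => ?_
          refine (Real.le_norm_self _).trans ?_
          rw [norm_mul]
          gcongr
          exact PiLp.norm_apply_le _ i
      _ = ‖x‖ * ‖Tstar (T x)‖ := by rw [← Finset.sum_mul, PiLp.norm_eq_of_L1]
      _ ≤ ‖x‖ * (c * ‖T x‖) := by gcongr; exact h _
      _ = c * ‖x‖ * ‖T x‖ := by ring
  exact le_of_mul_le_mul_right key hpos

theorem stmt_6
    (n m r : ℕ) (hn : 0 < n) (hm : 0 < m) (hr : 0 < r)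
    (T : PiLp 1 (fun _ : Fin n => ℝ) →L[ℝ] EuclideanSpace ℝ (Fin m))
    (hrank : Module.finrank ℝ
      (LinearMap.range (T : PiLp 1 (fun _ : Fin n => ℝ) →ₗ[ℝ] EuclideanSpace ℝ (Fin m))) ≤ r)
    -- the adjoint `T* : ℓ2^m → ℓ∞^n`, `(T*u)_i = ⟨T e_i, u⟩`
    (Tstar : EuclideanSpace ℝ (Fin m) →L[ℝ] PiLp ⊤ (fun _ : Fin n => ℝ))
    (hTstar : ∀ (u : EuclideanSpace ℝ (Fin m)) (i : Fin n),
      (WithLp.equiv ⊤ (Fin n → ℝ)) (Tstar u) i = ⟪T (l1basis n i), u⟫) :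
    ‖T‖ ≤ pi2 Tstar ∧ pi2 Tstar ≤ nu1 T ∧ nu1 T ≤ Real.sqrt (2 * r) * ‖T‖ := by
  have hadj (u : EuclideanSpace ℝ (Fin m)) (i : Fin n) : Tstar u i = ⟪T (l1basis n i), u⟫ :=
    hTstar u i
  have hmem {s : ℕ} (φ : Fin s → (PiLp 1 (fun _ : Fin n => ℝ) →L[ℝ] ℝ))
      (y : Fin s → EuclideanSpace ℝ (Fin m)) (hT : ∀ x, T x = ∑ j, φ j x • y j) :
      0 ≤ ∑ j, ‖φ j‖ * ‖y j‖ ∧ ∀ (k : ℕ) (x : Fin k → EuclideanSpace ℝ (Fin m)),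
        √(∑ i, ‖Tstar (x i)‖ ^ 2) ≤ (∑ j, ‖φ j‖ * ‖y j‖) *
          sSup {t | ∃ φ : EuclideanSpace ℝ (Fin m) →L[ℝ] ℝ, ‖φ‖ ≤ 1 ∧
            t = √(∑ i, (φ (x i)) ^ 2)} :=
    ⟨by positivity, fun k x => sqrt_sum_sq_adjoint_le T Tstar hadj φ y hT x⟩
  obtain ⟨s, φ, y, hT, hle⟩ := exists_nuclear_representation T
  refine ⟨le_csInf ⟨_, hmem φ y hT⟩ ?_, le_csInf ⟨_, s, φ, y, hT, rfl⟩ ?_, ?_⟩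
  · rintro c ⟨hc, h⟩
    refine norm_le_of_norm_adjoint_le T Tstar hadj hc fun u => ?_
    have h1 := h 1 fun _ => u
    simp only [Finset.univ_unique, Finset.sum_const, Finset.card_singleton, one_smul,
      Real.sqrt_sq_eq_abs, abs_norm] at h1
    refine h1.trans (mul_le_mul_of_nonneg_left (Real.sSup_le ?_ (norm_nonneg u)) hc)
    rintro _ ⟨ψ, hψ, rfl⟩
    exact (ψ.le_opNorm u).trans (mul_le_of_le_one_left (norm_nonneg u) hψ)
  · rintro _ ⟨s', φ', y', hT', rfl⟩
    exact csInf_le ⟨0, fun c hc => hc.1⟩ (hmem φ' y' hT')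
  · have hnu : nu1 T ≤ ∑ j, ‖φ j‖ * ‖y j‖ := by
      refine csInf_le ⟨0, ?_⟩ ⟨s, φ, y, hT, rfl⟩
      rintro _ ⟨_, _, _, _, rfl⟩
      positivity
    refine hnu.trans (hle.trans ?_)
    gcongr
end

section
/- Let M ∈ ℝ^{d1×d2}. Then the mixed norm ‖M‖_mixed := inf{‖U‖_F ‖Vᵀ‖_{1→2} : M = U Vᵀ} equals the optimal value of the semidefinite program: infimum, over symmetric matrices W1 ∈ ℝ^{d1×d1} and W2 ∈ ℝ^{d2×d2} such that the block matrix [[W1, M],[Mᵀ, W2]] is positive semidefinite, of max(trace(W1), max_{1≤j≤d2} (W2)_{jj}). -/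
open Real Set Matrix

noncomputable def frobNorm {m n : ℕ} (M : Matrix (Fin m) (Fin n) ℝ) : ℝ :=
  Real.sqrt (∑ i, ∑ j, (M i j)^2)

/-- maximum ℓ2 norm of the columns of `M`, i.e. `‖M‖_{1→2}` -/
noncomputable def norm12 {m n : ℕ} (M : Matrix (Fin m) (Fin n) ℝ) : ℝ :=
  ⨆ j, Real.sqrt (∑ i, (M i j)^2)

/-- `‖M‖_mixed = inf { ‖U‖_F ‖Vᵀ‖_{1→2} : M = U Vᵀ }` -/
noncomputable def mixedNorm {d1 d2 : ℕ} (M : Matrix (Fin d1) (Fin d2) ℝ) : ℝ :=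
  sInf {c | ∃ (d : ℕ) (U : Matrix (Fin d1) (Fin d) ℝ) (V : Matrix (Fin d2) (Fin d) ℝ),
    M = U * Vᵀ ∧ c = frobNorm U * norm12 Vᵀ}

lemma frobNorm_nonneg {m n : ℕ} (M : Matrix (Fin m) (Fin n) ℝ) : 0 ≤ frobNorm M :=
  Real.sqrt_nonneg _

lemma norm12_nonneg {m n : ℕ} (M : Matrix (Fin m) (Fin n) ℝ) : 0 ≤ norm12 M :=
  Real.iSup_nonneg fun _ => Real.sqrt_nonneg _

lemma frobNorm_sq {m n : ℕ} (M : Matrix (Fin m) (Fin n) ℝ) :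
    frobNorm M ^ 2 = (M * Mᵀ).trace := by
  rw [frobNorm, Real.sq_sqrt (by positivity)]
  simp [Matrix.trace, Matrix.mul_apply, sq]

lemma mul_transpose_diag_le_norm12_sq {m n : ℕ} (V : Matrix (Fin n) (Fin m) ℝ) (j : Fin n) :
    (V * Vᵀ) j j ≤ norm12 Vᵀ ^ 2 := by
  have h : √(∑ i, (Vᵀ i j) ^ 2) ≤ norm12 Vᵀ :=
    le_ciSup (f := fun j => √(∑ i, (Vᵀ i j) ^ 2)) (Set.finite_range _).bddAbove j
  have h2 := (Real.sqrt_le_left (norm12_nonneg _)).1 h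
  simpa [Matrix.mul_apply, sq] using h2

lemma eq_zero_of_frobNorm_eq_zero {m n : ℕ} {U : Matrix (Fin m) (Fin n) ℝ}
    (h : frobNorm U = 0) : U = 0 := by
  have h2 := frobNorm_sq U
  rw [h, ← Matrix.conjTranspose_eq_transpose_of_trivial, zero_pow two_ne_zero] at h2
  exact Matrix.trace_mul_conjTranspose_self_eq_zero_iff.1 h2.symm

lemma eq_zero_of_norm12_transpose_eq_zero {m n : ℕ} {V : Matrix (Fin n) (Fin m) ℝ}
    (h : norm12 Vᵀ = 0) : V = 0 := by
  rw [← Matrix.trace_mul_conjTranspose_self_eq_zero_iff,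
    Matrix.conjTranspose_eq_transpose_of_trivial]
  refine Finset.sum_eq_zero fun j _ => le_antisymm ?_ ?_
  · simpa [h] using mul_transpose_diag_le_norm12_sq V j
  · simp only [Matrix.diag_apply, Matrix.mul_apply, Matrix.transpose_apply]
    exact Finset.sum_nonneg fun i _ => mul_self_nonneg _

/-- A positive semidefinite block matrix is the Gram matrix of the rows of some `U` and `V`. -/
lemma exists_factorization_of_posSemidef_fromBlocks {d1 d2 : ℕ}
    {M : Matrix (Fin d1) (Fin d2) ℝ} {W1 : Matrix (Fin d1) (Fin d1) ℝ}
    {W2 : Matrix (Fin d2) (Fin d2) ℝ} (h : (Matrix.fromBlocks W1 M Mᵀ W2).PosSemidef) :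
    ∃ (d : ℕ) (U : Matrix (Fin d1) (Fin d) ℝ) (V : Matrix (Fin d2) (Fin d) ℝ),
      W1 = U * Uᵀ ∧ M = U * Vᵀ ∧ W2 = V * Vᵀ := by
  obtain ⟨d, v, hv⟩ := Matrix.posSemidef_iff_eq_sum_vecMulVec.1 h
  have entry : ∀ p q, Matrix.fromBlocks W1 M Mᵀ W2 p q = ∑ k, v k p * v k q := by
    intro p q
    simp [hv, Matrix.sum_apply, Matrix.vecMulVec_apply]
  refine ⟨d, Matrix.of fun i k => v k (Sum.inl i), Matrix.of fun j k => v k (Sum.inr j),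
    ?_, ?_, ?_⟩
  · ext i i'
    simpa [Matrix.mul_apply] using entry (Sum.inl i) (Sum.inl i')
  · ext i j
    simpa [Matrix.mul_apply] using entry (Sum.inl i) (Sum.inr j)
  · ext j j'
    simpa [Matrix.mul_apply] using entry (Sum.inr j) (Sum.inr j')

lemma posSemidef_fromBlocks_of_factorization {d1 d2 d : ℕ} (U : Matrix (Fin d1) (Fin d) ℝ)
    (V : Matrix (Fin d2) (Fin d) ℝ) :
    (Matrix.fromBlocks (U * Uᵀ) (U * Vᵀ) (U * Vᵀ)ᵀ (V * Vᵀ)).PosSemidef := by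
  have h := Matrix.posSemidef_self_mul_conjTranspose (Matrix.fromRows U V)
  rwa [Matrix.conjTranspose_eq_transpose_of_trivial, Matrix.transpose_fromRows,
    Matrix.fromRows_mul_fromCols, ← Matrix.transpose_transpose (V * Uᵀ), Matrix.transpose_mul V,
    Matrix.transpose_transpose] at h

lemma frobNorm_mul_norm12_le_max {d1 d2 d : ℕ} (U : Matrix (Fin d1) (Fin d) ℝ)
    (V : Matrix (Fin d2) (Fin d) ℝ) :
    frobNorm U * norm12 Vᵀ ≤ max (U * Uᵀ).trace (⨆ j, (V * Vᵀ) j j) := by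
  set c := max (U * Uᵀ).trace (⨆ j, (V * Vᵀ) j j)
  have hU : frobNorm U ≤ √c := Real.le_sqrt_of_sq_le (by
    rw [frobNorm_sq]; exact le_max_left _ _)
  have hV : norm12 Vᵀ ≤ √c := by
    refine Real.iSup_le (fun j => Real.sqrt_le_sqrt ?_) (Real.sqrt_nonneg _)
    refine le_trans ?_ ((le_ciSup (f := fun j => (V * Vᵀ) j j)
      (Set.finite_range _).bddAbove j).trans (le_max_right _ _))
    simp [Matrix.mul_apply, sq]
  have hc : 0 ≤ c := (sq_nonneg (frobNorm U)).trans ((frobNorm_sq U).trans_le (le_max_left _ _))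
  calc frobNorm U * norm12 Vᵀ ≤ √c * √c :=
        mul_le_mul hU hV (norm12_nonneg _) (Real.sqrt_nonneg _)
    _ = c := Real.mul_self_sqrt hc

/-- Rescaling `U` and `V` to balance the two norms gives a feasible point of the semidefinite
program whose value is at most the value of the factorization. -/
lemma exists_posSemidef_fromBlocks_le {d1 d2 d : ℕ} (U : Matrix (Fin d1) (Fin d) ℝ)
    (V : Matrix (Fin d2) (Fin d) ℝ) :
    ∃ (W1 : Matrix (Fin d1) (Fin d1) ℝ) (W2 : Matrix (Fin d2) (Fin d2) ℝ),
      W1.IsSymm ∧ W2.IsSymm ∧ (Matrix.fromBlocks W1 (U * Vᵀ) (U * Vᵀ)ᵀ W2).PosSemidef ∧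
      max W1.trace (⨆ j, W2 j j) ≤ frobNorm U * norm12 Vᵀ := by
  rcases eq_or_ne (frobNorm U * norm12 Vᵀ) 0 with h0 | h0
  · have hM : U * Vᵀ = 0 := by
      rcases mul_eq_zero.1 h0 with h | h
      · rw [eq_zero_of_frobNorm_eq_zero h, Matrix.zero_mul]
      · rw [eq_zero_of_norm12_transpose_eq_zero h, Matrix.transpose_zero, Matrix.mul_zero]
    refine ⟨0, 0, Matrix.isSymm_zero, Matrix.isSymm_zero, ?_, ?_⟩
    · rw [hM, Matrix.transpose_zero, Matrix.fromBlocks_zero]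
      exact Matrix.PosSemidef.zero
    · simp [h0]
  · have ha : 0 < frobNorm U := (frobNorm_nonneg U).lt_of_ne' (left_ne_zero_of_mul h0)
    have hb : 0 < norm12 Vᵀ := (norm12_nonneg _).lt_of_ne' (right_ne_zero_of_mul h0)
    set a := frobNorm U with ha_def
    set b := norm12 Vᵀ with hb_def
    have hs : 0 < √(b / a) := Real.sqrt_pos.2 (div_pos hb ha)
    have hss : √(b / a) * √(b / a) = b / a := Real.mul_self_sqrt (div_pos hb ha).le
    have h := posSemidef_fromBlocks_of_factorization (√(b / a) • U) ((√(b / a))⁻¹ • V)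
    simp only [Matrix.transpose_smul, Matrix.smul_mul, Matrix.mul_smul, smul_smul, hss,
      ← mul_inv, inv_mul_cancel₀ hs.ne', one_smul] at h
    refine ⟨(b / a) • (U * Uᵀ), (b / a)⁻¹ • (V * Vᵀ), ?_, ?_, h, max_le ?_ ?_⟩
    · exact Matrix.IsSymm.smul (by simp [Matrix.IsSymm, Matrix.transpose_mul]) _
    · exact Matrix.IsSymm.smul (by simp [Matrix.IsSymm, Matrix.transpose_mul]) _
    · rw [Matrix.trace_smul, ← frobNorm_sq, ← ha_def, smul_eq_mul]
      exact le_of_eq (by field_simp)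
    · refine Real.iSup_le (fun j => ?_) (mul_pos ha hb).le
      calc ((b / a)⁻¹ • (V * Vᵀ)) j j ≤ (b / a)⁻¹ * b ^ 2 :=
            mul_le_mul_of_nonneg_left (mul_transpose_diag_le_norm12_sq V j)
              (inv_nonneg.2 (div_pos hb ha).le)
        _ = a * b := by field_simp

theorem stmt_9
    (d1 d2 : ℕ) (hd1 : 0 < d1) (hd2 : 0 < d2)
    (M : Matrix (Fin d1) (Fin d2) ℝ) :
    mixedNorm M = sInf {c | ∃ (W1 : Matrix (Fin d1) (Fin d1) ℝ)
      (W2 : Matrix (Fin d2) (Fin d2) ℝ),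
      W1.IsSymm ∧ W2.IsSymm ∧ (Matrix.fromBlocks W1 M Mᵀ W2).PosSemidef ∧
      c = max (Matrix.trace W1) (⨆ j, W2 j j)} := by
  refine csInf_eq_csInf_of_forall_exists_le ?_ ?_
  · rintro _ ⟨d, U, V, rfl, rfl⟩
    obtain ⟨W1, W2, h1, h2, hpos, hle⟩ := exists_posSemidef_fromBlocks_le U V
    exact ⟨_, ⟨W1, W2, h1, h2, hpos, rfl⟩, hle⟩
  · rintro _ ⟨W1, W2, -, -, hpos, rfl⟩
    obtain ⟨d, U, V, rfl, hM, rfl⟩ := exists_factorization_of_posSemidef_fromBlocks hpos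
    exact ⟨_, ⟨d, U, V, hM, rfl⟩, frobNorm_mul_norm12_le_max U V⟩
end
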